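/- arXiv:math/0505121 — 5 statements merged into one kernel-verified Lean document; each statement's English description precedes it below -/
import Mathlib

section
/- Let τ ∈ ℝ, let k ≥ 1 be a natural number, and let w ∈ ℂ with Re w > τ. Then the function y ↦ e^(−(τ+iy)) · ((τ+iy) − w)^(−(k+1)) is integrable on ℝ, and (1/(2πi)) · ∫_ℝ e^(−(τ+iy)) · ((τ+iy) − w)^(−(k+1)) · i dy = (−1)^(k+1) · e^(−w) / k!. -/
open MeasureTheory Set Complex Filter Real

open scoped FourierTransform

/-- `t ^ n * exp (-b t)` is integrable on `(0, ∞)` when `Re b > 0`. -/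
lemma integrableOn_pow_mul_cexp_neg_mul_Ioi (n : ℕ) {b : ℂ} (hb : 0 < b.re) :
    IntegrableOn (fun t : ℝ => (t : ℂ) ^ n * cexp (-b * t)) (Ioi 0) := by
  have h := integrableOn_rpow_mul_exp_neg_mul_rpow (p := 1) (s := n) (b := b.re)
    (by linarith [n.cast_nonneg (α := ℝ)]) one_pos hb
  refine Integrable.mono' h (by fun_prop) ?_
  filter_upwards [ae_restrict_mem measurableSet_Ioi] with t ht
  have ht' : (0 : ℝ) < t := ht
  simp [Complex.norm_exp, abs_of_pos ht']

/-- The Laplace transform of `t ^ n`, at a complex parameter. -/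
lemma integral_pow_mul_cexp_neg_mul_Ioi (n : ℕ) {b : ℂ} (hb : 0 < b.re) :
    ∫ t : ℝ in Ioi 0, (t : ℂ) ^ n * cexp (-b * t) = n.factorial / b ^ (n + 1) := by
  have hb0 : b ≠ 0 := by
    rintro rfl
    simp at hb
  induction n with
  | zero =>
    have h := integral_exp_mul_complex_Ioi (a := -b) (by simpa using hb) 0
    simpa [neg_div] using h
  | succ n ih =>
    have hderiv : ∀ t ∈ Ioi (0 : ℝ), HasDerivAt (fun t : ℝ => (t : ℂ) ^ (n + 1) * cexp (-b * t))
        ((n + 1) * ((t : ℂ) ^ n * cexp (-b * t)) - b * ((t : ℂ) ^ (n + 1) * cexp (-b * t))) t := by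
      intro t _
      have hp := (hasDerivAt_pow (n + 1) (t : ℂ))
      have he := ((hasDerivAt_id (t : ℂ)).const_mul (-b)).cexp
      convert! (hp.mul he).comp_ofReal using 1
      simp
      ring
    have hi := integrableOn_pow_mul_cexp_neg_mul_Ioi n hb
    have hi' := integrableOn_pow_mul_cexp_neg_mul_Ioi (n + 1) hb
    have hlim : Tendsto (fun t : ℝ => (t : ℂ) ^ (n + 1) * cexp (-b * t)) atTop (nhds 0) := by
      rw [tendsto_zero_iff_norm_tendsto_zero]
      refine (tendsto_rpow_mul_exp_neg_mul_atTop_nhds_zero ((n + 1 : ℕ) : ℝ) b.re hb).congr' ?_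
      filter_upwards [eventually_gt_atTop 0] with t ht
      rw [Real.rpow_natCast]
      simp [Complex.norm_exp, abs_of_pos ht]
    have h := integral_Ioi_of_hasDerivAt_of_tendsto (Continuous.continuousWithinAt (by fun_prop))
      hderiv ((hi.const_mul _).sub (hi'.const_mul _)) hlim
    rw [integral_sub (hi.const_mul _) (hi'.const_mul _), integral_const_mul,
      integral_const_mul, ih] at h
    simp only [ofReal_zero, ne_eq, Nat.add_eq_zero_iff, one_ne_zero, and_false,
      not_false_eq_true, zero_pow, zero_mul, sub_zero, sub_eq_zero] at h
    apply mul_left_cancel₀ hb0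
    rw [← h, Nat.factorial_succ]
    push_cast
    field_simp
    ring

/-- The Fourier transform of `t ^ n * exp (-a t)` supported on `(0, ∞)`. -/
lemma fourier_indicator_pow_mul_cexp (n : ℕ) {a : ℂ} (ha : 0 < a.re) (ξ : ℝ) :
    𝓕 ((Ioi 0).indicator fun t : ℝ => (t : ℂ) ^ n * cexp (-a * t)) ξ =
      n.factorial / (a + 2 * π * ξ * I) ^ (n + 1) := by
  rw [fourier_real_eq_integral_exp_smul,
    ← integral_pow_mul_cexp_neg_mul_Ioi n (b := a + 2 * π * ξ * I) (by simpa using ha),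
    ← integral_indicator measurableSet_Ioi]
  congr 1 with t
  by_cases ht : t ∈ Ioi (0 : ℝ)
  · simp only [indicator_of_mem ht, smul_eq_mul]
    rw [mul_left_comm, ← Complex.exp_add]
    push_cast
    ring_nf
  · simp [indicator_of_notMem ht]

/-- Powers of order at least two of the resolvent are integrable along a vertical line. -/
lemma integrable_vertical_sub_zpow_neg {τ : ℝ} {w : ℂ} (hw : τ ≠ w.re) {k : ℕ} (hk : 1 ≤ k) :
    Integrable fun y : ℝ => ((τ : ℂ) + y * I - w) ^ (-((k : ℤ) + 1)) := by
  obtain ⟨m, rfl⟩ := Nat.exists_eq_add_of_le' hk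
  set d := |τ - w.re| with hd
  have hd0 : 0 < d := abs_pos.2 (sub_ne_zero.2 hw)
  have hlow (y : ℝ) : d ≤ ‖(τ : ℂ) + y * I - w‖ := by
    simpa using abs_re_le_norm ((τ : ℂ) + y * I - w)
  have hne (y : ℝ) : (τ : ℂ) + y * I - w ≠ 0 := norm_pos_iff.1 (hd0.trans_le (hlow y))
  have hsq (y : ℝ) : ‖(τ : ℂ) + y * I - w‖ ^ 2 = d ^ 2 * (1 + (d⁻¹ * (y - w.im)) ^ 2) := by
    rw [Complex.sq_norm, Complex.normSq_apply]
    simp only [sub_re, add_re, ofReal_re, mul_re, I_re, mul_zero, ofReal_im, I_im, mul_one,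
      sub_self, add_zero, sub_im, add_im, mul_im, zero_add]
    field_simp
    rw [hd, sq_abs]
  have hint : Integrable fun y : ℝ =>
      (d ^ (m + 2))⁻¹ * (1 + (d⁻¹ * (y - w.im)) ^ 2)⁻¹ :=
    ((integrable_inv_one_add_sq.comp_mul_left' (inv_ne_zero hd0.ne')).comp_sub_right
      w.im).const_mul _
  refine hint.mono' ?_ (Eventually.of_forall fun y => ?_)
  · exact (Continuous.zpow₀ (by fun_prop) _ fun y => Or.inl (hne y)).aestronglyMeasurable
  · rw [norm_zpow, zpow_neg, ← mul_inv]
    have hcast : (((m + 1 : ℕ) : ℤ) + 1) = ((m + 2 : ℕ) : ℤ) := by push_cast; ring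
    rw [hcast, zpow_natCast]
    apply inv_anti₀ (by positivity)
    rw [pow_add, mul_assoc, ← hsq, pow_add]
    gcongr
    exact hlow y

/-- Pointwise content of Lemma 6.3 of the paper: for a vertical contour `Re λ = τ` lying to
the left of `w` (i.e. `τ < Re w`) and `k ≥ 1`,
`(1/2πi) ∫_γ e^(-λ) (λ - w)^(-(k+1)) dλ = (-1)^(k+1) e^(-w) / k!`. -/
theorem cauchy_exp_resolvent_power (τ : ℝ) (k : ℕ) (hk : 1 ≤ k) (w : ℂ)
    (hw : τ < w.re) :
    Integrable (fun y : ℝ =>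
      Complex.exp (-((τ : ℂ) + y * Complex.I)) *
        (((τ : ℂ) + y * Complex.I) - w) ^ (-((k : ℤ) + 1))) ∧
    (1 / (2 * (Real.pi : ℂ) * Complex.I)) *
        ∫ y : ℝ, Complex.exp (-((τ : ℂ) + y * Complex.I)) *
          (((τ : ℂ) + y * Complex.I) - w) ^ (-((k : ℤ) + 1)) * Complex.I =
      (-1 : ℂ) ^ (k + 1) * Complex.exp (-w) / (k.factorial : ℂ) := by
  have hres := integrable_vertical_sub_zpow_neg hw.ne hk
  refine ⟨hres.bdd_mul (c := rexp (-τ)) (by fun_prop)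
    (Eventually.of_forall fun y => by simp [Complex.norm_exp]), ?_⟩
  have ha : 0 < (w - τ).re := by simpa using hw
  have hπ : -(2 * π) ≠ 0 := neg_ne_zero.2 two_pi_pos.ne'
  have hfact : (k.factorial : ℂ) ≠ 0 := Nat.cast_ne_zero.2 k.factorial_ne_zero
  have hsign : ((-1 : ℂ) ^ (k + 1)) * (-1) ^ (k + 1) = 1 := by rw [← mul_pow]; simp
  set f : ℝ → ℂ := (Ioi 0).indicator fun t : ℝ => (t : ℂ) ^ k * cexp (-(w - τ) * t) with hf
  have hzpow (ξ : ℝ) : ((τ : ℂ) + (-(2 * π) * ξ : ℝ) * I - w) ^ (-((k : ℤ) + 1)) =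
      (-1) ^ (k + 1) / (w - τ + 2 * π * ξ * I) ^ (k + 1) := by
    have hbase : (τ : ℂ) + (-(2 * π) * ξ : ℝ) * I - w = -1 * (w - τ + 2 * π * ξ * I) := by
      push_cast
      ring
    have hcast : -((k : ℤ) + 1) = -((k + 1 : ℕ) : ℤ) := by push_cast; ring
    rw [hbase, hcast, zpow_neg, zpow_natCast, mul_pow, mul_inv, ← inv_pow, inv_neg_one,
      div_eq_mul_inv]
  have hfourier (ξ : ℝ) : 𝓕 f ξ = (-1) ^ (k + 1) * k.factorial *
      ((τ : ℂ) + (-(2 * π) * ξ : ℝ) * I - w) ^ (-((k : ℤ) + 1)) := by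
    rw [hf, fourier_indicator_pow_mul_cexp k ha, hzpow]
    linear_combination (-(k.factorial / (w - τ + 2 * π * ξ * I) ^ (k + 1))) * hsign
  have hfi : Integrable f :=
    (integrable_indicator_iff measurableSet_Ioi).2 (integrableOn_pow_mul_cexp_neg_mul_Ioi k ha)
  have hFi : Integrable (𝓕 f) := by
    rw [funext hfourier]
    exact (hres.comp_mul_left' hπ).const_mul _
  have hcont : ContinuousAt f 1 := by
    have hc : Continuous fun t : ℝ => (t : ℂ) ^ k * cexp (-(w - τ) * t) := by fun_prop
    refine hc.continuousAt.congr ?_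
    filter_upwards [Ioi_mem_nhds one_pos] with t ht
    rw [hf, indicator_of_mem ht]
  have hinv := hfi.fourierInv_fourier_eq hFi hcont
  have hf1 : f 1 = cexp (-(w - τ)) := by simp [hf]
  have hscale := Measure.integral_comp_mul_left (fun y : ℝ =>
    cexp (-((τ : ℂ) + y * I)) * ((τ : ℂ) + y * I - w) ^ (-((k : ℤ) + 1))) (-(2 * π))
  have hval : 𝓕⁻ (𝓕 f) 1 = (-1) ^ (k + 1) * k.factorial * cexp τ *
      ∫ ξ : ℝ, cexp (-((τ : ℂ) + (-(2 * π) * ξ : ℝ) * I)) *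
        ((τ : ℂ) + (-(2 * π) * ξ : ℝ) * I - w) ^ (-((k : ℤ) + 1)) := by
    rw [fourierInv_eq', ← integral_const_mul]
    congr 1 with ξ
    have hexp : cexp (((2 * π * inner ℝ ξ 1 : ℝ) : ℂ) * I) =
        cexp τ * cexp (-((τ : ℂ) + (-(2 * π) * ξ : ℝ) * I)) := by
      rw [← Complex.exp_add]
      congr 1
      simp
    rw [hfourier, hexp, smul_eq_mul]
    ring
  rw [hscale, hinv, hf1, neg_sub, sub_eq_add_neg, Complex.exp_add, mul_comm _ (cexp τ)] at hval
  have hval' : cexp (-w) = _ := mul_left_cancel₀ (Complex.exp_ne_zero τ)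
    (hval.trans (mul_assoc _ _ _))
  rw [integral_mul_const, hval', inv_neg, abs_neg, abs_of_pos (inv_pos.2 two_pi_pos), real_smul]
  generalize (∫ y : ℝ, cexp (-((τ : ℂ) + y * I)) *
    ((τ : ℂ) + y * I - w) ^ (-((k : ℤ) + 1))) = J
  push_cast
  field_simp
  linear_combination -J * hsign
end

section
/- Let z, w ∈ ℂ with Re z > 0, and let τ ∈ ℝ with 0 < τ < Re w. Then the function y ↦ (τ+iy)^(−z) · ((τ+iy) − w)^(−1) is integrable on ℝ, and (1/(2πi)) · ∫_ℝ (τ+iy)^(−z) · ((τ+iy) − w)^(−1) · i dy = −w^(−z), where all complex powers are principal-branch powers. -/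
open MeasureTheory Set Complex Filter

open Bornology Topology in
/-- **Cauchy's theorem on a closed half-plane**: if `f` is holomorphic on `τ ≤ Re s` and
`s * f s → 0` at infinity there, then the symmetric integrals of `f` along the boundary line
tend to zero. -/
theorem tendsto_intervalIntegral_vertical_of_tendsto_mul {f : ℂ → ℂ} {τ : ℝ} (hτ : 0 ≤ τ)
    (hf : DifferentiableOn ℂ f {s | τ ≤ s.re})
    (hlim : Tendsto (fun s => s * f s) (cobounded ℂ ⊓ 𝓟 {s | τ ≤ s.re}) (𝓝 0)) :
    Tendsto (fun R : ℝ => ∫ y in (-R)..R, f (τ + y * I)) atTop (𝓝 0) := by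
  rw [Metric.tendsto_nhds]
  intro ε hε
  have hsmall : ∀ᶠ s in cobounded ℂ ⊓ 𝓟 {s | τ ≤ s.re}, ‖s * f s‖ < ε / 5 := by
    simpa using (Metric.tendsto_nhds.1 hlim (ε / 5) (by positivity))
  rw [eventually_inf_principal, hasBasis_cobounded_norm.eventually_iff] at hsmall
  obtain ⟨R₀, -, hR₀⟩ := hsmall
  filter_upwards [eventually_ge_atTop R₀, eventually_gt_atTop 0] with R hR hRpos
  have bound : ∀ s : ℂ, τ ≤ s.re → R ≤ ‖s‖ → ‖f s‖ ≤ ε / 5 / R := by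
    intro s hs hRs
    have h := hR₀ (show R₀ ≤ ‖s‖ from hR.trans hRs) hs
    rw [norm_mul] at h
    rw [le_div_iff₀ hRpos]
    nlinarith [mul_le_mul_of_nonneg_right hRs (norm_nonneg (f s))]
  have rect := integral_boundary_rect_eq_zero_of_differentiableOn f
    (⟨τ, -R⟩ : ℂ) (⟨τ + R, R⟩ : ℂ) (hf.mono fun s hs => by
      have := (mem_reProdIm.1 hs).1
      rw [uIcc_of_le (by simp [hRpos.le])] at this
      exact this.1)
  simp only at rect
  have bottom := intervalIntegral.norm_integral_le_of_norm_le_const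
    (a := τ) (b := τ + R) (f := fun x : ℝ => f (x + (-R : ℝ) * I)) (C := ε / 5 / R) fun x hx => by
      rw [uIoc_of_le (by linarith)] at hx
      refine bound _ (by simpa using hx.1.le) ?_
      simpa [abs_of_pos hRpos] using abs_im_le_norm ((x : ℂ) + (-R : ℝ) * I)
  have top := intervalIntegral.norm_integral_le_of_norm_le_const
    (a := τ) (b := τ + R) (f := fun x : ℝ => f (x + R * I)) (C := ε / 5 / R) fun x hx => by
      rw [uIoc_of_le (by linarith)] at hx
      refine bound _ (by simpa using hx.1.le) ?_
      simpa [abs_of_pos hRpos] using abs_im_le_norm ((x : ℂ) + R * I)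
  have right := intervalIntegral.norm_integral_le_of_norm_le_const
    (a := -R) (b := R) (f := fun y : ℝ => f ((τ + R : ℝ) + y * I)) (C := ε / 5 / R)
    fun y _ => by
      refine bound _ (by simpa using hRpos.le) ?_
      refine le_trans ?_ (re_le_norm _)
      simpa using hτ
  rw [show |τ + R - τ| = R by rw [add_sub_cancel_left, abs_of_pos hRpos],
    div_mul_cancel₀ _ hRpos.ne'] at bottom top
  rw [show |R - -R| = R * 2 by rw [sub_neg_eq_add, abs_of_pos (by linarith)]; ring,
    ← mul_assoc, div_mul_cancel₀ _ hRpos.ne'] at right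
  rw [dist_zero_right, ← one_mul ‖_‖, ← norm_I, ← norm_mul, ← smul_eq_mul,
    ← sub_eq_zero.1 rect]
  refine (norm_add_le _ _).trans_lt ?_
  rw [norm_smul, norm_I, one_mul]
  linarith [norm_sub_le (∫ x in τ..(τ + R), f (x + (-R : ℝ) * I)) (∫ x in τ..(τ + R), f (x + R * I))]

/-- The distance from a point off a vertical line to the points of that line grows linearly. -/
theorem exists_one_add_abs_le_mul_norm_vertical_sub {τ : ℝ} {u : ℂ} (hu : u.re ≠ τ) :
    ∃ K : ℝ, 0 < K ∧ ∀ y : ℝ, 1 + |y| ≤ K * ‖(τ : ℂ) + y * I - u‖ := by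
  have ha : 0 < |τ - u.re| := abs_pos.2 (sub_ne_zero.2 hu.symm)
  refine ⟨(1 + |u.im|) / |τ - u.re| + 1, by positivity, fun y => ?_⟩
  have hre : |τ - u.re| ≤ ‖(τ : ℂ) + y * I - u‖ := by
    simpa using abs_re_le_norm ((τ : ℂ) + y * I - u)
  have him : |y - u.im| ≤ ‖(τ : ℂ) + y * I - u‖ := by
    simpa using abs_im_le_norm ((τ : ℂ) + y * I - u)
  have h₁ : 1 + |u.im| ≤ (1 + |u.im|) / |τ - u.re| * ‖(τ : ℂ) + y * I - u‖ := by
    rw [div_mul_eq_mul_div, le_div_iff₀ ha]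
    gcongr
  have h₂ : |y| ≤ |y - u.im| + |u.im| := by simpa using abs_add_le (y - u.im) u.im
  linarith

/-- A power with fixed exponent is bounded by the real power of the norm, up to a constant. -/
theorem norm_cpow_le_mul_exp (s z : ℂ) :
    ‖s ^ z‖ ≤ Real.exp (Real.pi * |z.im|) * ‖s‖ ^ z.re := by
  refine (norm_cpow_le s z).trans ?_
  rw [div_eq_mul_inv, ← Real.exp_neg, mul_comm]
  gcongr
  calc -(arg s * z.im) ≤ |arg s * z.im| := neg_le_abs _
    _ = |arg s| * |z.im| := abs_mul _ _
    _ ≤ Real.pi * |z.im| := by gcongr; exact abs_arg_le_pi s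

open Bornology Topology in
theorem tendsto_cpow_neg_cobounded {z : ℂ} (hz : 0 < z.re) :
    Tendsto (fun s : ℂ => s ^ (-z)) (cobounded ℂ) (𝓝 0) := by
  refine squeeze_zero_norm (fun s => norm_cpow_le_mul_exp s (-z)) ?_
  simpa using ((tendsto_rpow_neg_atTop hz).comp tendsto_norm_cobounded_atTop).const_mul
    (Real.exp (Real.pi * |(-z).im|))

theorem integrable_vertical_cpow_neg_mul_inv_sub {z w : ℂ} (hz : 0 < z.re) {τ : ℝ} (hτ : 0 < τ)
    (hw : w.re ≠ τ) :
    Integrable (fun y : ℝ => ((τ : ℂ) + y * I) ^ (-z) * (((τ : ℂ) + y * I) - w)⁻¹) := by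
  obtain ⟨K, hK, hK'⟩ := exists_one_add_abs_le_mul_norm_vertical_sub (τ := τ) (u := 0)
    (by simpa using hτ.ne)
  obtain ⟨L, hL, hL'⟩ := exists_one_add_abs_le_mul_norm_vertical_sub hw
  have hdom : Integrable (fun y : ℝ => (1 + ‖y‖) ^ (-(1 + z.re))) :=
    integrable_one_add_norm (by simpa using hz)
  have hne : ∀ y : ℝ, (τ : ℂ) + y * I - w ≠ 0 := fun y h => hw <| by
    simpa [sub_eq_zero, eq_comm] using congrArg re h
  have hcont : Continuous
      (fun y : ℝ => ((τ : ℂ) + y * I) ^ (-z) * (((τ : ℂ) + y * I) - w)⁻¹) := by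
    refine Continuous.mul (Continuous.cpow (by fun_prop) continuous_const fun y => ?_)
      (Continuous.inv₀ (by fun_prop) hne)
    exact Or.inl (by simpa using hτ)
  refine (hdom.const_mul (Real.exp (Real.pi * |(-z).im|) * K ^ z.re * L)).mono'
    hcont.aestronglyMeasurable (Eventually.of_forall fun y => ?_)
  have hpos : 0 < 1 + |y| := by positivity
  have hs : (1 + |y|) / K ≤ ‖(τ : ℂ) + y * I‖ := by
    rw [div_le_iff₀' hK]; simpa using hK' y
  have hpow : ‖(τ : ℂ) + y * I‖ ^ (-z).re ≤ K ^ z.re * (1 + |y|) ^ (-z.re) := by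
    calc ‖(τ : ℂ) + y * I‖ ^ (-z).re ≤ ((1 + |y|) / K) ^ (-z).re :=
          Real.rpow_le_rpow_of_nonpos (by positivity) hs (by simpa using hz.le)
      _ = K ^ z.re * (1 + |y|) ^ (-z.re) := by
          rw [neg_re, Real.div_rpow hpos.le hK.le, Real.rpow_neg hK.le, div_inv_eq_mul, mul_comm]
  have hinv : ‖(τ : ℂ) + y * I - w‖⁻¹ ≤ L * (1 + |y|)⁻¹ := by
    rw [← div_eq_mul_inv, le_div_iff₀ hpos, inv_mul_le_iff₀ (norm_pos_iff.2 (hne y)), mul_comm]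
    exact hL' y
  rw [norm_mul, norm_inv]
  calc ‖((τ : ℂ) + y * I) ^ (-z)‖ * ‖(τ : ℂ) + y * I - w‖⁻¹
      ≤ (Real.exp (Real.pi * |(-z).im|) * (K ^ z.re * (1 + |y|) ^ (-z.re))) *
          (L * (1 + |y|)⁻¹) := by
        gcongr
        exact (norm_cpow_le_mul_exp _ _).trans (by gcongr)
    _ = _ := by
        rw [neg_add_rev, Real.norm_eq_abs, Real.rpow_add hpos, Real.rpow_neg_one]
        ring

/-- The Poisson kernel of the half-plane `τ < Re s`, written as a difference of resolvents at `w`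
and at its reflection in the boundary line. -/
theorem inv_sub_sub_inv_sub_reflection {w : ℂ} {τ : ℝ} (hw : τ < w.re) (y : ℝ) :
    ((τ : ℂ) + y * I - w)⁻¹ - ((τ : ℂ) + y * I - (2 * τ - (starRingEnd ℂ) w))⁻¹ =
      ((-(2 / (w.re - τ)) * (1 + ((y - w.im) / (w.re - τ)) ^ 2)⁻¹ : ℝ) : ℂ) := by
  have ha : 0 < w.re - τ := sub_pos.2 hw
  have h₁ : (τ : ℂ) + y * I - w ≠ 0 := fun h => by
    have := congrArg re h; simp at this; linarith
  have h₂ : (τ : ℂ) + y * I - (2 * τ - (starRingEnd ℂ) w) ≠ 0 := fun h => by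
    have := congrArg re h; simp at this; linarith
  have hprod : ((τ : ℂ) + y * I - w) * ((τ : ℂ) + y * I - (2 * τ - (starRingEnd ℂ) w)) =
      ((-((w.re - τ) ^ 2 + (y - w.im) ^ 2) : ℝ) : ℂ) := by
    apply Complex.ext <;> (simp [pow_two]; ring)
  have hsub : ((τ : ℂ) + y * I - (2 * τ - (starRingEnd ℂ) w)) - ((τ : ℂ) + y * I - w) =
      ((2 * (w.re - τ) : ℝ) : ℂ) := by
    apply Complex.ext <;> simp; ring
  rw [inv_sub_inv h₁ h₂, hprod, hsub, ← ofReal_div, ofReal_inj]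
  have h₃ : (w.re - τ) ^ 2 + (y - w.im) ^ 2 ≠ 0 := by positivity
  field_simp

theorem integrable_inv_sub_sub_inv_sub_reflection {w : ℂ} {τ : ℝ} (hw : τ < w.re) :
    Integrable (fun y : ℝ => ((τ : ℂ) + y * I - w)⁻¹ -
      ((τ : ℂ) + y * I - (2 * τ - (starRingEnd ℂ) w))⁻¹) := by
  simp_rw [inv_sub_sub_inv_sub_reflection hw]
  exact (((integrable_inv_one_add_sq.comp_div (sub_pos.2 hw).ne').comp_sub_right w.im).const_mul
    _).ofReal

theorem integral_inv_sub_sub_inv_sub_reflection {w : ℂ} {τ : ℝ} (hw : τ < w.re) :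
    ∫ y : ℝ, (((τ : ℂ) + y * I - w)⁻¹ - ((τ : ℂ) + y * I - (2 * τ - (starRingEnd ℂ) w))⁻¹) =
      -(2 * Real.pi) := by
  have ha : 0 < w.re - τ := sub_pos.2 hw
  simp_rw [inv_sub_sub_inv_sub_reflection hw]
  rw [integral_complex_ofReal, integral_const_mul,
    integral_sub_right_eq_self (f := fun x : ℝ => (1 + (x / (w.re - τ)) ^ 2)⁻¹),
    Measure.integral_comp_div (g := fun x : ℝ => (1 + x ^ 2)⁻¹), integral_univ_inv_one_add_sq,
    abs_of_pos ha, smul_eq_mul]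
  rw [show -(2 / (w.re - τ)) * ((w.re - τ) * Real.pi) = -(2 * Real.pi) by field_simp]
  push_cast
  rfl

open Bornology Topology in
theorem integral_vertical_cpow_neg_mul_inv_sub {z w : ℂ} (hz : 0 < z.re) {τ : ℝ} (hτ : 0 < τ)
    (hw : τ < w.re) :
    ∫ y : ℝ, ((τ : ℂ) + y * I) ^ (-z) * (((τ : ℂ) + y * I) - w)⁻¹ =
      -(2 * Real.pi) * w ^ (-z) := by
  set v : ℂ := 2 * τ - (starRingEnd ℂ) w with hv
  have hvre : v.re < τ := by simp [hv]; linarith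
  have hwv : w - v ≠ 0 := fun h => by
    have := congrArg re h; simp at this; linarith
  -- `h` vanishes at `w` and at infinity, so Cauchy's theorem applies to its divided difference.
  let h : ℂ → ℂ := fun s => s ^ (-z) - w ^ (-z) * ((w - v) * (s - v)⁻¹)
  have hhw : h w = 0 := by simp [h, hwv]
  have hds : ∀ s, s ≠ w → dslope h w s = h s * (s - w)⁻¹ := fun s hs => by
    rw [dslope_of_ne _ hs, slope_def_field, hhw, sub_zero, div_eq_mul_inv]
  have hdiff : DifferentiableOn ℂ (dslope h w) {s | τ ≤ s.re} := by
    have hopen : IsOpen {s : ℂ | max 0 v.re < s.re} := isOpen_lt continuous_const continuous_re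
    have hmem : {s : ℂ | max 0 v.re < s.re} ∈ 𝓝 w :=
      hopen.mem_nhds (max_lt (hτ.trans hw) (hvre.trans hw))
    refine DifferentiableOn.mono ((differentiableOn_dslope hmem).2 fun s hs => ?_)
      fun s hs => (max_lt hτ hvre).trans_le hs
    have hs0 : 0 < s.re := (le_max_left _ _).trans_lt hs
    have hsv : s - v ≠ 0 := fun e => by
      have h₁ := congrArg re e
      have h₂ : v.re < s.re := (le_max_right _ _).trans_lt hs
      simp at h₁; linarith
    refine DifferentiableAt.differentiableWithinAt ?_
    exact (differentiableAt_id.cpow_const (Or.inl hs0)).sub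
      ((((differentiableAt_id.sub_const v).inv hsv).const_mul _).const_mul _)
  have hinv : ∀ u : ℂ, Tendsto (fun s : ℂ => (s - u)⁻¹) (cobounded ℂ) (𝓝 0) := fun u =>
    tendsto_inv₀_cobounded.comp (tendsto_sub_const_cobounded u)
  have hh0 : Tendsto h (cobounded ℂ) (𝓝 0) := by
    simpa using (tendsto_cpow_neg_cobounded hz).sub
      (((hinv v).const_mul (w - v)).const_mul (w ^ (-z)))
  have hlim : Tendsto (fun s => s * dslope h w s) (cobounded ℂ) (𝓝 0) := by
    have : Tendsto (fun s => h s * (1 + w * (s - w)⁻¹)) (cobounded ℂ) (𝓝 0) := by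
      simpa using hh0.mul (((hinv w).const_mul w).const_add 1)
    refine this.congr' ?_
    filter_upwards [isBounded_singleton (x := w)] with s hs
    have hs : s ≠ w := hs
    have := sub_ne_zero.2 hs
    rw [hds s hs]
    field_simp
    ring
  have hline : ∀ y : ℝ, dslope h w ((τ : ℂ) + y * I) =
      ((τ : ℂ) + y * I) ^ (-z) * (((τ : ℂ) + y * I) - w)⁻¹ -
        w ^ (-z) * (((τ : ℂ) + y * I - w)⁻¹ - ((τ : ℂ) + y * I - v)⁻¹) := fun y => by
    have h₁ : (τ : ℂ) + y * I - w ≠ 0 := fun e => by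
      have := congrArg re e; simp at this; linarith
    have h₂ : (τ : ℂ) + y * I - v ≠ 0 := fun e => by
      have := congrArg re e
      simp only [sub_re, add_re, ofReal_re, re_ofReal_mul, I_re, mul_zero, add_zero,
        zero_re] at this
      linarith
    rw [hds _ (sub_ne_zero.1 h₁), inv_sub_inv h₁ h₂]
    simp only [h]
    field_simp
    ring
  have hint₁ := integrable_vertical_cpow_neg_mul_inv_sub hz hτ hw.ne'
  have hint₂ := (integrable_inv_sub_sub_inv_sub_reflection hw).const_mul (w ^ (-z))
  have hzero : ∫ y : ℝ, dslope h w ((τ : ℂ) + y * I) = 0 := by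
    refine tendsto_nhds_unique (intervalIntegral_tendsto_integral ?_ tendsto_neg_atTop_atBot
      tendsto_id) (tendsto_intervalIntegral_vertical_of_tendsto_mul hτ.le hdiff
        (hlim.mono_left inf_le_left))
    simp_rw [hline]
    exact hint₁.sub hint₂
  simp_rw [hline] at hzero
  rw [integral_sub hint₁ hint₂, integral_const_mul, integral_inv_sub_sub_inv_sub_reflection hw,
    sub_eq_zero] at hzero
  rw [hzero, mul_comm]

/-- Pointwise content of the holomorphic-functional-calculus formula
`(-∇_L²)^(-z) = (1/2πi) ∫_γ λ^(-z)(λ + ∇_L²)^(-1) dλ`: for `Re z > 0` and a vertical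
contour `Re λ = τ` with `0 < τ < Re w`,
`(1/2πi) ∫_γ λ^(-z) (λ - w)^(-1) dλ = -w^(-z)`. -/
theorem cauchy_cpow_resolvent (z w : ℂ) (hz : 0 < z.re) (τ : ℝ) (hτ : 0 < τ)
    (hτw : τ < w.re) :
    Integrable (fun y : ℝ =>
      ((τ : ℂ) + y * Complex.I) ^ (-z) * (((τ : ℂ) + y * Complex.I) - w)⁻¹) ∧
    (1 / (2 * (Real.pi : ℂ) * Complex.I)) *
        ∫ y : ℝ, ((τ : ℂ) + y * Complex.I) ^ (-z) *
          (((τ : ℂ) + y * Complex.I) - w)⁻¹ * Complex.I =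
      -w ^ (-z) := by
  refine ⟨integrable_vertical_cpow_neg_mul_inv_sub hz hτ hτw.ne', ?_⟩
  rw [integral_mul_const, integral_vertical_cpow_neg_mul_inv_sub hz hτ hτw]
  have hπ : (Real.pi : ℂ) ≠ 0 := ofReal_ne_zero.2 Real.pi_ne_zero
  field_simp [I_ne_zero]
end

section
/- Let w ∈ ℂ with Re w > 0 and let c > 0. Then the function y ↦ Γ(c+iy) · w^(−(c+iy)) is integrable on ℝ, and (1/(2πi)) · ∫_ℝ Γ(c+iy) · w^(−(c+iy)) · i dy = e^(−w). -/
open MeasureTheory Set Complex Filter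

lemma mellinConvergent_cexp_neg_mul {w s : ℂ} (hw : 0 < w.re) (hs : 0 < s.re) :
    MellinConvergent (fun t : ℝ ↦ cexp (-(w * t))) s := by
  refine mellinConvergent_of_isBigO_rpow_exp (a := w.re) (b := 0) hw
    ((Continuous.locallyIntegrable (by fun_prop)).locallyIntegrableOn _) ?_ ?_ hs
  · refine Asymptotics.isBigO_of_le _ fun t ↦ ?_
    simp [norm_exp]
  · simp only [neg_zero, Real.rpow_zero]
    have h : ContinuousAt (fun t : ℝ ↦ cexp (-(w * t))) 0 := by fun_prop
    exact h.norm.isBoundedUnder_le.isBigO_one ℝ |>.mono nhdsWithin_le_nhds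

lemma differentiableAt_mellin_cexp_neg_mul {w s : ℂ} (hw : 0 < w.re) (hs : 0 < s.re) :
    DifferentiableAt ℂ (fun v : ℂ ↦ mellin (fun t : ℝ ↦ cexp (-(v * t))) s) w := by
  have hnhds : {v : ℂ | w.re / 2 < v.re} ∈ nhds w :=
    (isOpen_lt continuous_const continuous_re).mem_nhds (by simp only [mem_ofPred_eq]; linarith)
  have hhalf : 0 < ((w.re / 2 : ℝ) : ℂ).re := by simpa using hw
  have hmeas (a v : ℂ) : AEStronglyMeasurable
      (fun t : ℝ ↦ (t : ℂ) ^ a • cexp (-(v * t))) (volume.restrict (Ioi 0)) :=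
    (ContinuousOn.smul (fun t ht ↦ (continuousAt_ofReal_cpow_const _ _
      (Or.inr (ne_of_gt ht))).continuousWithinAt) (by fun_prop)).aestronglyMeasurable
      measurableSet_Ioi
  have hcongr : ∀ t ∈ Ioi (0 : ℝ), ∀ v : ℂ, (t : ℂ) ^ (s - 1) * (cexp (-(v * t)) * -(t : ℂ)) =
      -((t : ℂ) ^ (s + 1 - 1) • cexp (-(v * t))) := fun t ht v ↦ by
    have ht0 : (t : ℂ) ≠ 0 := ofReal_ne_zero.mpr (ne_of_gt ht)
    rw [show s + 1 - 1 = (s - 1) + 1 by ring, cpow_add _ _ ht0, cpow_one, smul_eq_mul]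
    ring
  have hs1 : 0 < (s + 1).re := by simp; linarith
  refine (hasDerivAt_integral_of_dominated_loc_of_deriv_le
    (F := fun (v : ℂ) (t : ℝ) ↦ (t : ℂ) ^ (s - 1) • cexp (-(v * t)))
    (F' := fun (v : ℂ) (t : ℝ) ↦ (t : ℂ) ^ (s - 1) * (cexp (-(v * t)) * -(t : ℂ)))
    (bound := fun t : ℝ ↦ ‖(t : ℂ) ^ (s + 1 - 1) • cexp (-(((w.re / 2 : ℝ) : ℂ) * t))‖)
    hnhds (.of_forall fun v ↦ hmeas _ v) (mellinConvergent_cexp_neg_mul hw hs) ?_ ?_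
    (mellinConvergent_cexp_neg_mul hhalf hs1).norm ?_).2.differentiableAt
  · exact (hmeas (s + 1 - 1) w).neg.congr
      ((ae_restrict_mem measurableSet_Ioi).mono fun t ht ↦ (hcongr t ht w).symm)
  · filter_upwards [ae_restrict_mem measurableSet_Ioi] with t ht v hv
    rw [hcongr t ht v, norm_neg, norm_smul, norm_smul]
    gcongr
    simp only [mem_Ioi] at ht hv
    rw [norm_exp, norm_exp]
    have : w.re / 2 * t ≤ v.re * t := by gcongr
    simpa using this
  · refine .of_forall fun t v _ ↦ ?_
    have h := ((hasDerivAt_id v).mul_const (t : ℂ)).neg.cexp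
    simpa using h.const_mul ((t : ℂ) ^ (s - 1))

/-- The Mellin transform of `t ↦ exp (-(w * t))` for `w` in the right half-plane. -/
lemma mellin_cexp_neg_mul {w s : ℂ} (hw : 0 < w.re) (hs : 0 < s.re) :
    mellin (fun t : ℝ ↦ cexp (-(w * t))) s = Gamma s * w ^ (-s) := by
  have hopen : IsOpen {v : ℂ | 0 < v.re} := isOpen_lt continuous_const continuous_re
  have hleft : AnalyticOnNhd ℂ (fun v : ℂ ↦ mellin (fun t : ℝ ↦ cexp (-(v * t))) s)
      {v : ℂ | 0 < v.re} :=
    DifferentiableOn.analyticOnNhd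
      (fun v hv ↦ (differentiableAt_mellin_cexp_neg_mul hv hs).differentiableWithinAt) hopen
  have hright : AnalyticOnNhd ℂ (fun v : ℂ ↦ Gamma s * v ^ (-s)) {v : ℂ | 0 < v.re} :=
    DifferentiableOn.analyticOnNhd (fun v hv ↦
      ((differentiableAt_id.cpow_const (Or.inl hv)).const_mul _).differentiableWithinAt) hopen
  refine hleft.eqOn_of_preconnected_of_frequently_eq hright
    (convex_halfSpace_re_gt 0).isPreconnected (z₀ := 1) (by simp) ?_ hw
  have hreal (r : ℝ) (hr : 0 < r) :
      mellin (fun t : ℝ ↦ cexp (-((r : ℂ) * t))) s = Gamma s * (r : ℂ) ^ (-s) := by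
    have h := integral_cpow_mul_exp_neg_mul_Ioi hs hr
    rw [mellin]
    simp only [smul_eq_mul]
    rw [h, one_div, ← ofReal_inv, ofReal_inv,
      inv_cpow _ _ (by rw [arg_ofReal_of_nonneg hr.le]; exact Real.pi_pos.ne), cpow_neg, mul_comm]
  have hfreq : ∃ᶠ r : ℝ in nhdsWithin 1 {1}ᶜ,
      mellin (fun t : ℝ ↦ cexp (-((r : ℂ) * t))) s = Gamma s * (r : ℂ) ^ (-s) :=
    (eventually_nhdsWithin_of_eventually_nhds
      ((eventually_gt_nhds one_pos).mono hreal)).frequently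
  have htend : Tendsto (fun r : ℝ ↦ (r : ℂ)) (nhdsWithin 1 {1}ᶜ) (nhdsWithin 1 {1}ᶜ) := by
    refine tendsto_nhdsWithin_iff.mpr ⟨?_, ?_⟩
    · exact (continuous_ofReal.tendsto' 1 1 (by simp)).mono_left nhdsWithin_le_nhds
    · filter_upwards [self_mem_nhdsWithin] with r hr
      simpa using hr
  exact htend.frequently hfreq

/-- Along a vertical line in the right half-plane, `Γ` decays like `exp (-θ * |Im s|)` for every
`θ < π / 2`. -/
lemma exists_norm_Gamma_le_mul_exp_neg_mul_abs {c θ : ℝ} (hc : 0 < c) (hθ0 : 0 ≤ θ)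
    (hθ : θ < Real.pi / 2) :
    ∃ C : ℝ, ∀ y : ℝ, ‖Gamma (c + y * I)‖ ≤ C * Real.exp (-(θ * |y|)) := by
  refine ⟨∫ t in Ioi (0 : ℝ), t ^ (c - 1) * Real.exp (-(Real.cos θ * t)), fun y ↦ ?_⟩
  have key (φ : ℝ) (hφ : |φ| = θ) (hφy : φ * y = θ * |y|) :
      ‖Gamma (c + y * I)‖ ≤ (∫ t in Ioi (0 : ℝ), t ^ (c - 1) * Real.exp (-(Real.cos θ * t))) *
        Real.exp (-(θ * |y|)) := by
    have hφ' := abs_lt.mp (hφ.trans_lt hθ)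
    have hre : (cexp (φ * I)).re = Real.cos θ := by
      rw [exp_ofReal_mul_I_re, ← hφ, Real.cos_abs]
    have hcos : 0 < Real.cos θ := Real.cos_pos_of_mem_Ioo ⟨by linarith, hθ⟩
    have hnorm : ‖cexp (φ * I) ^ (-(c + y * I : ℂ))‖ = Real.exp (θ * |y|) := by
      rw [norm_cpow_of_ne_zero (exp_ne_zero _), norm_exp_ofReal_mul_I, Real.one_rpow,
        arg_exp_mul_I, toIocMod_eq_self _ |>.mpr ⟨by linarith, by linarith⟩, one_div,
        ← Real.exp_neg, ← hφy]
      simp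
    have hmellin := mellin_cexp_neg_mul (w := cexp (φ * I)) (s := c + y * I)
      (by rwa [hre]) (by simpa using hc)
    rw [Real.exp_neg, ← div_eq_mul_inv, le_div_iff₀ (Real.exp_pos _), ← hnorm, ← norm_mul,
      ← hmellin, mellin]
    refine (norm_integral_le_integral_norm _).trans_eq
      (setIntegral_congr_fun measurableSet_Ioi fun t ht ↦ ?_)
    simp only [norm_smul]
    rw [norm_cpow_eq_rpow_re_of_pos ht, norm_exp]
    simp [← hre]
  rcases le_total 0 y with hy | hy
  · exact key θ (abs_of_nonneg hθ0) (by rw [abs_of_nonneg hy])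
  · exact key (-θ) (by rw [abs_neg, abs_of_nonneg hθ0]) (by rw [abs_of_nonpos hy]; ring)

lemma integrable_exp_neg_mul_abs {a : ℝ} (ha : 0 < a) :
    Integrable fun y : ℝ ↦ Real.exp (-(a * |y|)) := by
  rw [← integrableOn_univ, ← Iic_union_Ioi (a := (0 : ℝ)), integrableOn_union]
  refine ⟨(integrableOn_exp_mul_Iic ha 0).congr_fun (fun y hy ↦ ?_) measurableSet_Iic,
    (integrableOn_exp_mul_Ioi (neg_lt_zero.mpr ha) 0).congr_fun (fun y hy ↦ ?_) measurableSet_Ioi⟩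
  · simp [abs_of_nonpos (mem_Iic.mp hy)]
  · simp [abs_of_pos (mem_Ioi.mp hy)]

lemma integrable_Gamma_mul_cpow_neg {w : ℂ} (hw : 0 < w.re) {c : ℝ} (hc : 0 < c) :
    Integrable fun y : ℝ ↦ Gamma (c + y * I) * w ^ (-(c + y * I : ℂ)) := by
  have hw0 : w ≠ 0 := by rintro rfl; simp at hw
  obtain ⟨θ, hargθ, hθ⟩ := exists_between (abs_arg_lt_pi_div_two_iff.mpr (Or.inl hw))
  obtain ⟨C, hC⟩ := exists_norm_Gamma_le_mul_exp_neg_mul_abs hc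
    ((abs_nonneg _).trans hargθ.le) hθ
  refine ((integrable_exp_neg_mul_abs (sub_pos.mpr hargθ)).const_mul
    (C * ‖w‖ ^ (-c))).mono' ?_ (.of_forall fun y ↦ ?_)
  · refine Continuous.aestronglyMeasurable (continuous_iff_continuousAt.mpr fun y ↦ ?_)
    have hΓ : ContinuousAt Gamma (c + y * I) := by
      refine (differentiableAt_Gamma _ fun m h ↦ ?_).continuousAt
      have := congrArg re h
      simp at this
      have : (0 : ℝ) ≤ m := m.cast_nonneg
      linarith
    refine (hΓ.comp (f := fun y : ℝ ↦ (c + y * I : ℂ)) (by fun_prop)).mul ?_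
    exact ContinuousAt.const_cpow (by fun_prop) (Or.inl hw0)
  · have hpow : ‖w ^ (-(c + y * I : ℂ))‖ ≤ ‖w‖ ^ (-c) * Real.exp (|arg w| * |y|) := by
      rw [norm_cpow_of_ne_zero hw0, div_eq_mul_inv, ← Real.exp_neg]
      simp only [neg_re, add_re, ofReal_re, mul_re, I_re, mul_zero, ofReal_im, I_im, mul_one,
        sub_self, add_zero, neg_im, add_im, mul_im, zero_add, mul_neg, neg_neg]
      refine mul_le_mul_of_nonneg_left (Real.exp_le_exp.mpr ?_) (by positivity)
      exact (le_abs_self _).trans_eq (abs_mul _ _)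
    calc ‖Gamma (c + y * I) * w ^ (-(c + y * I : ℂ))‖
        ≤ (C * Real.exp (-(θ * |y|))) * (‖w‖ ^ (-c) * Real.exp (|arg w| * |y|)) := by
          rw [norm_mul]
          exact mul_le_mul (hC y) hpow (norm_nonneg _) ((norm_nonneg _).trans (hC y))
      _ = C * ‖w‖ ^ (-c) * Real.exp (-((θ - |arg w|) * |y|)) := by
          rw [mul_mul_mul_comm, ← Real.exp_add]
          ring_nf

/-- Mellin inversion (scalar form of step (3) of the proof of Theorem 2): for `Re w > 0`
and `c > 0`, `(1/2πi) ∫_{Re z = c} Γ(z) w^(-z) dz = e^(-w)`. -/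
theorem mellin_inversion_exp (w : ℂ) (hw : 0 < w.re) (c : ℝ) (hc : 0 < c) :
    Integrable (fun y : ℝ =>
      Complex.Gamma ((c : ℂ) + y * Complex.I) * w ^ (-((c : ℂ) + y * Complex.I))) ∧
    (1 / (2 * (Real.pi : ℂ) * Complex.I)) *
        ∫ y : ℝ, Complex.Gamma ((c : ℂ) + y * Complex.I) *
          w ^ (-((c : ℂ) + y * Complex.I)) * Complex.I =
      Complex.exp (-w) := by
  have hint := integrable_Gamma_mul_cpow_neg hw hc
  have hmellin (y : ℝ) : mellin (fun t : ℝ ↦ cexp (-(w * t))) (c + y * I) =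
      Gamma (c + y * I) * w ^ (-(c + y * I : ℂ)) :=
    mellin_cexp_neg_mul hw (by simpa using hc)
  refine ⟨hint, ?_⟩
  have hinv := mellinInv_mellin_eq c (fun t : ℝ ↦ cexp (-(w * t))) one_pos
    (mellinConvergent_cexp_neg_mul hw (by simpa using hc))
    (by simpa only [VerticalIntegrable, hmellin] using hint) (by fun_prop)
  simp only [mellinInv, hmellin, ofReal_one, one_cpow, one_smul, mul_one] at hinv
  rw [← hinv, integral_mul_const, real_smul]
  have hpi : (Real.pi : ℂ) ≠ 0 := ofReal_ne_zero.mpr Real.pi_ne_zero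
  push_cast
  field_simp
end

section
/- Let g : ℂ → ℂ be entire and suppose there exist constants C, c > 0 such that |g(z)| ≤ C · e^(−c·Re z) for all z ∈ ℂ. Then for every t > 0 and every a > 0: the series Σ_{m=0}^∞ ((−1)^m / m!) · g(−m) · t^m converges absolutely, the function y ↦ t^(−(a+iy)) · Γ(a+iy) · g(a+iy) is integrable on ℝ, and (1/(2πi)) · ∫_ℝ t^(−(a+iy)) · Γ(a+iy) · g(a+iy) · i dy = Σ_{m=0}^∞ ((−1)^m / m!) · g(−m) · t^m. -/
open MeasureTheory Set Complex Filter

/-- An entire function bounded by `C * exp (-c * re z)` is a multiple of `exp (-c * z)`. -/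
lemma eq_mul_exp_of_norm_le_exp_re {g : ℂ → ℂ} (hg : Differentiable ℂ g) {C c : ℝ}
    (hbound : ∀ z : ℂ, ‖g z‖ ≤ C * Real.exp (-c * z.re)) :
    ∃ K : ℂ, ∀ z : ℂ, g z = K * cexp (-c * z) := by
  have hd : Differentiable ℂ fun z : ℂ => g z * cexp (c * z) := by fun_prop
  obtain ⟨K, hK⟩ := hd.exists_const_forall_eq_of_bounded (by
    refine isBounded_iff_forall_norm_le.2 ⟨C, ?_⟩
    rintro _ ⟨z, rfl⟩
    calc ‖g z * cexp (c * z)‖ = ‖g z‖ * Real.exp (c * z.re) := by simp [Complex.norm_exp]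
      _ ≤ C * Real.exp (-c * z.re) * Real.exp (c * z.re) := by gcongr; exact hbound z
      _ = C := by rw [mul_assoc, ← Real.exp_add]; simp)
  refine ⟨K, fun z => ?_⟩
  rw [← hK z, mul_assoc, ← Complex.exp_add]
  simp

lemma norm_Gamma_le_Gamma_re {s : ℂ} (hs : 0 < s.re) : ‖Complex.Gamma s‖ ≤ Real.Gamma s.re := by
  rw [Complex.Gamma_eq_integral hs, Complex.GammaIntegral, Real.Gamma_eq_integral hs]
  refine (norm_integral_le_integral_norm _).trans_eq ?_
  refine setIntegral_congr_fun measurableSet_Ioi fun x hx => ?_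
  simp only [norm_mul, norm_cpow_eq_rpow_re_of_pos hx, sub_re, one_re]
  rw [Complex.norm_of_nonneg (Real.exp_pos _).le]

lemma norm_Gamma_le_div {s : ℂ} (hs : 0 < s.re) :
    ‖Complex.Gamma s‖ ≤ Real.Gamma (s.re + 2) / ‖s‖ ^ 2 := by
  have hs0 : s ≠ 0 := by rintro rfl; simp at hs
  have hs1 : s + 1 ≠ 0 := fun h => by
    have := congrArg re h
    simp at this
    linarith
  have hle : ‖s‖ ≤ ‖s + 1‖ := by
    rw [← sq_le_sq₀ (norm_nonneg _) (norm_nonneg _), Complex.sq_norm, Complex.sq_norm,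
      normSq_apply, normSq_apply]
    simp
    nlinarith
  have hΓ : Complex.Gamma (s + 2) = (s + 1) * (s * Complex.Gamma s) := by
    rw [← Complex.Gamma_add_one s hs0, ← Complex.Gamma_add_one _ hs1]
    ring_nf
  rw [le_div_iff₀ (by positivity)]
  calc ‖Complex.Gamma s‖ * ‖s‖ ^ 2 = ‖s‖ * (‖s‖ * ‖Complex.Gamma s‖) := by ring
    _ ≤ ‖s + 1‖ * (‖s‖ * ‖Complex.Gamma s‖) := by gcongr
    _ = ‖Complex.Gamma (s + 2)‖ := by rw [hΓ, norm_mul, norm_mul]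
    _ ≤ Real.Gamma (s.re + 2) := by
      simpa using norm_Gamma_le_Gamma_re (s := s + 2) (by simp; linarith)

lemma continuous_Gamma_vertical {a : ℝ} (ha : 0 < a) :
    Continuous fun y : ℝ => Complex.Gamma (a + y * I) := by
  refine continuous_iff_continuousAt.2 fun y => ?_
  refine ContinuousAt.comp (f := fun y : ℝ => (a : ℂ) + y * I) (g := Complex.Gamma) ?_
    (by fun_prop)
  refine (Complex.differentiableAt_Gamma _ fun m h => ?_).continuousAt
  have := congrArg re h
  simp at this
  have : (0 : ℝ) ≤ m := m.cast_nonneg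
  linarith

lemma verticalIntegrable_Gamma {a : ℝ} (ha : 0 < a) : VerticalIntegrable Complex.Gamma a := by
  have hint : Integrable fun y : ℝ => Real.Gamma (a + 2) / a ^ 2 * (1 + (y / a) ^ 2)⁻¹ :=
    (integrable_inv_one_add_sq.comp_div ha.ne').const_mul _
  refine hint.mono' (continuous_Gamma_vertical ha).aestronglyMeasurable (.of_forall fun y => ?_)
  refine (norm_Gamma_le_div (by simpa using ha)).trans_eq ?_
  rw [Complex.sq_norm, normSq_apply]
  simp
  field_simp

/-- The Cahen–Mellin integral. -/
lemma mellinInv_Gamma {a x : ℝ} (ha : 0 < a) (hx : 0 < x) :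
    mellinInv a Complex.Gamma x = cexp (-x) := by
  have hline : ∀ y : ℝ, Complex.Gamma (a + y * I) =
      mellin (fun u : ℝ => (Real.exp (-u) : ℂ)) (a + y * I) := fun y => by
    rw [Complex.Gamma_eq_integral (by simpa using ha), Complex.GammaIntegral_eq_mellin]
  have hconv : MellinConvergent (fun u : ℝ => (Real.exp (-u) : ℂ)) a := by
    simpa [MellinConvergent, mul_comm] using
      Complex.GammaIntegral_convergent (s := a) (by simpa using ha)
  have hvert : VerticalIntegrable (mellin fun u : ℝ => (Real.exp (-u) : ℂ)) a := by
    simpa only [VerticalIntegrable, hline] using verticalIntegrable_Gamma ha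
  have h := mellinInv_mellin_eq a _ hx hconv hvert (by fun_prop)
  simp only [mellinInv, ← hline] at h
  simpa [mellinInv] using h

lemma integrable_cpow_mul_Gamma {a x : ℝ} (ha : 0 < a) (hx : 0 < x) :
    Integrable fun y : ℝ => (x : ℂ) ^ (-((a : ℂ) + y * I)) * Complex.Gamma (a + y * I) := by
  have hx0 : (x : ℂ) ≠ 0 := ofReal_ne_zero.2 hx.ne'
  refine (verticalIntegrable_Gamma ha).bdd_mul (c := x ^ (-a)) ?_ (.of_forall fun y => ?_)
  · refine Continuous.aestronglyMeasurable ?_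
    exact Continuous.const_cpow (by fun_prop) (Or.inl hx0)
  · rw [norm_cpow_eq_rpow_re_of_pos hx]
    simp

/-- Residue-collecting principle (steps (3)–(4) of the proof of Theorem 2): if `g` is
entire and `|g(z)| ≤ C e^(-c Re z)`, then for `t > 0`, `a > 0`, the inverse Mellin
transform `(1/2πi) ∫_{Re z = a} t^(-z) Γ(z) g(z) dz` equals the absolutely convergent sum
of the residues `Σ_m ((-1)^m/m!) g(-m) t^m` of `t^(-z) Γ(z) g(z)`. -/
theorem inverse_mellin_eq_sum_residues (g : ℂ → ℂ) (hg : Differentiable ℂ g)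
    (C c : ℝ) (hC : 0 < C) (hc : 0 < c)
    (hbound : ∀ z : ℂ, ‖g z‖ ≤ C * Real.exp (-c * z.re)) :
    ∀ t : ℝ, 0 < t → ∀ a : ℝ, 0 < a →
      Summable (fun m : ℕ =>
        ‖((-1 : ℂ) ^ m / (m.factorial : ℂ)) * g (-(m : ℂ)) * (t : ℂ) ^ m‖) ∧
      Integrable (fun y : ℝ =>
        (t : ℂ) ^ (-((a : ℂ) + y * Complex.I)) *
          Complex.Gamma ((a : ℂ) + y * Complex.I) * g ((a : ℂ) + y * Complex.I)) ∧
      (1 / (2 * (Real.pi : ℂ) * Complex.I)) *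
          ∫ y : ℝ, (t : ℂ) ^ (-((a : ℂ) + y * Complex.I)) *
            Complex.Gamma ((a : ℂ) + y * Complex.I) * g ((a : ℂ) + y * Complex.I) *
              Complex.I =
        ∑' m : ℕ, ((-1 : ℂ) ^ m / (m.factorial : ℂ)) * g (-(m : ℂ)) * (t : ℂ) ^ m := by
  intro t ht a ha
  obtain ⟨K, hK⟩ := eq_mul_exp_of_norm_le_exp_re hg hbound
  set x : ℝ := t * Real.exp c with hxdef
  have hx : 0 < x := by positivity
  have hterm : ∀ m : ℕ, ((-1 : ℂ) ^ m / (m.factorial : ℂ)) * g (-(m : ℂ)) * (t : ℂ) ^ m =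
      K * ((-(x : ℂ)) ^ m / (m.factorial : ℂ)) := fun m => by
    rw [hK, show -(c : ℂ) * -(m : ℂ) = m * c by ring, Complex.exp_nat_mul,
      neg_pow (x : ℂ) m, hxdef]
    push_cast
    ring
  have hintegrand : ∀ y : ℝ, (t : ℂ) ^ (-((a : ℂ) + y * I)) * Complex.Gamma (a + y * I) *
      g (a + y * I) = K * ((x : ℂ) ^ (-((a : ℂ) + y * I)) * Complex.Gamma (a + y * I)) := fun y => by
    have hexp : ((Real.exp c : ℝ) : ℂ) ^ (-((a : ℂ) + y * I)) = cexp (-c * (a + y * I)) := by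
      rw [cpow_def_of_ne_zero (ofReal_ne_zero.2 (Real.exp_ne_zero c)),
        ← ofReal_log (Real.exp_pos c).le, Real.log_exp]
      ring_nf
    rw [hK, hxdef, ofReal_mul, mul_cpow_ofReal_nonneg ht.le (Real.exp_pos c).le, hexp]
    ring
  have hinv : (1 / (2 * Real.pi) : ℂ) *
      ∫ y : ℝ, (x : ℂ) ^ (-((a : ℂ) + y * I)) * Complex.Gamma (a + y * I) = cexp (-x) := by
    simpa [mellinInv] using mellinInv_Gamma ha hx
  simp only [hterm, hintegrand]
  refine ⟨?_, (integrable_cpow_mul_Gamma ha hx).const_mul K, ?_⟩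
  · simp only [norm_mul]
    exact (NormedSpace.norm_expSeries_div_summable (-(x : ℂ))).mul_left _
  · rw [integral_mul_const, integral_const_mul, tsum_mul_left,
      (NormedSpace.expSeries_div_hasSum_exp (-(x : ℂ))).tsum_eq, ← Complex.exp_eq_exp_ℂ, ← hinv]
    have := I_ne_zero
    field_simp
end

section
/- Let R > 0 and define F(z) = Γ(z+3) · R^(−2(z+2)) / (2(z+2)) for z ∈ ℂ, where R^w = exp(w · Real.log R). Then: (i) F is complex-differentiable on ℂ ∖ P, where P = {−2} ∪ {−3−m : m ∈ ℕ}; (ii) for every p ∈ P the limit r_p = lim_{z→p} (z−p)·F(z) exists and is nonzero (so each point of P is a simple pole); (iii) the family (r_p)_{p ∈ P} is absolutely summable with Σ_{p∈P} r_p = (1/2)·e^(−R²); and (iv) consequently lim_{R→0⁺} Σ_{p∈P} r_p = ∫₀^∞ e^(−ρ²) · ρ dρ = 1/2. -/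
open MeasureTheory Set Complex Filter

/-- The pole set `P = {-2} ∪ {-3 - m : m ∈ ℕ}`. -/
def deRhamPoleSet : Set ℂ := {(-2 : ℂ)} ∪ {z : ℂ | ∃ m : ℕ, z = -3 - (m : ℂ)}

/-- `F(z) = Γ(z+3) · R^(-2(z+2)) / (2(z+2))`. -/
noncomputable def deRhamZeta (R : ℝ) (z : ℂ) : ℂ :=
  Complex.Gamma (z + 3) * (R : ℂ) ^ (-2 * (z + 2)) / (2 * (z + 2))

theorem tendsto_add_const_nhdsNE {a b c : ℂ} (h : a + c = b) :
    Tendsto (fun z : ℂ => z + c) (nhdsWithin a {a}ᶜ) (nhdsWithin b {b}ᶜ) := by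
  subst h
  have hcont : ContinuousAt (fun z : ℂ => z + c) a := by fun_prop
  refine tendsto_nhdsWithin_iff.mpr ⟨hcont.tendsto.mono_left nhdsWithin_le_nhds, ?_⟩
  filter_upwards [self_mem_nhdsWithin] with z hz
  simpa using hz

/-- The residue of `Γ` at `-n` is `(-1)^n / n!`. -/
theorem tendsto_add_natCast_mul_Gamma (n : ℕ) :
    Tendsto (fun s : ℂ => (s + n) * Complex.Gamma s) (nhdsWithin (-n : ℂ) {(-n : ℂ)}ᶜ)
      (nhds ((-1) ^ n / (n.factorial : ℂ))) := by
  induction n with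
  | zero => simpa using Complex.tendsto_self_mul_Gamma_nhds_zero
  | succ n ih =>
    have hn : (-((n + 1 : ℕ) : ℂ)) ≠ 0 := neg_ne_zero.mpr (Nat.cast_ne_zero.mpr n.succ_ne_zero)
    have hshift : Tendsto (fun s : ℂ => s + 1)
        (nhdsWithin (-((n + 1 : ℕ) : ℂ)) {-((n + 1 : ℕ) : ℂ)}ᶜ)
        (nhdsWithin (-n : ℂ) {(-n : ℂ)}ᶜ) :=
      tendsto_add_const_nhdsNE (by push_cast; ring)
    have hid : Tendsto (fun s : ℂ => s) (nhdsWithin (-((n + 1 : ℕ) : ℂ)) {-((n + 1 : ℕ) : ℂ)}ᶜ)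
        (nhds (-((n + 1 : ℕ) : ℂ))) := nhdsWithin_le_nhds
    have hlim := (ih.comp hshift).div hid hn
    have hval : (-1 : ℂ) ^ n / (n.factorial : ℂ) / (-((n + 1 : ℕ) : ℂ)) =
        (-1) ^ (n + 1) / ((n + 1).factorial : ℂ) := by
      rw [Nat.factorial_succ, Nat.cast_mul, pow_succ, div_div, mul_neg_one, neg_div, mul_neg,
        div_neg, mul_comm (n.factorial : ℂ)]
    rw [hval] at hlim
    refine hlim.congr' ?_
    filter_upwards [hid.eventually_ne hn] with s hs
    simp only [Pi.div_apply, Function.comp_apply, Complex.Gamma_add_one s hs]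
    field_simp
    push_cast
    ring

theorem deRhamPoleSet_eq_range : deRhamPoleSet = range fun n : ℕ => (-2 - n : ℂ) := by
  ext z
  simp only [deRhamPoleSet, mem_union, mem_singleton_iff, mem_ofPred_eq, mem_range]
  constructor
  · rintro (rfl | ⟨m, rfl⟩)
    · exact ⟨0, by simp⟩
    · exact ⟨m + 1, by push_cast; ring⟩
  · rintro ⟨_ | m, rfl⟩
    · left; simp
    · exact Or.inr ⟨m, by push_cast; ring⟩

theorem differentiableOn_deRhamZeta {R : ℝ} (hR : 0 < R) :
    DifferentiableOn ℂ (deRhamZeta R) deRhamPoleSetᶜ := by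
  intro z hz
  have h2 : z + 2 ≠ 0 := fun h => hz (Or.inl (eq_neg_of_add_eq_zero_left h))
  have hΓ : DifferentiableAt ℂ Complex.Gamma (z + 3) :=
    Complex.differentiableAt_Gamma _ fun m hm => hz (Or.inr ⟨m, by linear_combination hm⟩)
  have hR' : (R : ℂ) ≠ 0 := by exact_mod_cast hR.ne'
  have hpow : DifferentiableAt ℂ (fun z : ℂ => (R : ℂ) ^ (-2 * (z + 2))) z :=
    DifferentiableAt.const_cpow (by fun_prop) (Or.inl hR')
  have hΓ' : DifferentiableAt ℂ (fun z : ℂ => Complex.Gamma (z + 3)) z :=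
    hΓ.comp z (by fun_prop : DifferentiableAt ℂ (fun z : ℂ => z + 3) z)
  have hden : DifferentiableAt ℂ (fun z : ℂ => 2 * (z + 2)) z := by fun_prop
  exact ((hΓ'.mul hpow).div hden (mul_ne_zero two_ne_zero h2)).differentiableWithinAt

theorem deRhamZeta_eq_Gamma_mul (R : ℝ) {z : ℂ} (hz : z + 2 ≠ 0) :
    deRhamZeta R z = Complex.Gamma (z + 2) * ((R : ℂ) ^ (-2 * (z + 2)) / 2) := by
  rw [deRhamZeta, show z + 3 = z + 2 + 1 by ring, Complex.Gamma_add_one _ hz]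
  field_simp

/-- The residue of `deRhamZeta R` at `-2 - n`. -/
theorem tendsto_sub_mul_deRhamZeta {R : ℝ} (hR : 0 < R) (n : ℕ) :
    Tendsto (fun z : ℂ => (z - (-2 - n)) * deRhamZeta R z)
      (nhdsWithin (-2 - n : ℂ) {(-2 - n : ℂ)}ᶜ)
      (nhds (1 / 2 * ((-(R : ℂ) ^ 2) ^ n / (n.factorial : ℂ)))) := by
  have hR' : (R : ℂ) ≠ 0 := by exact_mod_cast hR.ne'
  have hshift : Tendsto (fun z : ℂ => z + 2) (nhdsWithin (-2 - n : ℂ) {(-2 - n : ℂ)}ᶜ)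
      (nhdsWithin (-n : ℂ) {(-n : ℂ)}ᶜ) :=
    tendsto_add_const_nhdsNE (by ring)
  have hpow : Tendsto (fun z : ℂ => (R : ℂ) ^ (-2 * (z + 2)) / 2)
      (nhdsWithin (-2 - n : ℂ) {(-2 - n : ℂ)}ᶜ) (nhds ((R : ℂ) ^ (2 * n) / 2)) := by
    have h : ContinuousAt (fun z : ℂ => (R : ℂ) ^ (-2 * (z + 2)) / 2) (-2 - n : ℂ) :=
      (ContinuousAt.const_cpow (by fun_prop) (Or.inl hR')).div_const 2
    have h' := h.tendsto.mono_left (nhdsWithin_le_nhds (s := {(-2 - n : ℂ)}ᶜ))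
    rwa [show (-2 * (-2 - n + 2) : ℂ) = ((2 * n : ℕ) : ℂ) by push_cast; ring,
      Complex.cpow_natCast] at h'
  have hlim := ((tendsto_add_natCast_mul_Gamma n).comp hshift).mul hpow
  have hval : (-1) ^ n / (n.factorial : ℂ) * ((R : ℂ) ^ (2 * n) / 2) =
      1 / 2 * ((-(R : ℂ) ^ 2) ^ n / (n.factorial : ℂ)) := by
    rw [neg_pow ((R : ℂ) ^ 2), pow_mul]
    ring
  rw [hval] at hlim
  refine hlim.congr' ?_
  have hne : ∀ᶠ z : ℂ in nhdsWithin (-2 - n : ℂ) {(-2 - n : ℂ)}ᶜ, z + 2 ≠ 0 := by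
    rcases Nat.eq_zero_or_pos n with rfl | hn
    · filter_upwards [self_mem_nhdsWithin] with z hz h
      refine hz ?_
      simp only [mem_singleton_iff]
      push_cast
      linear_combination h
    · exact (hshift.mono_right nhdsWithin_le_nhds).eventually_ne
        (neg_ne_zero.mpr (Nat.cast_ne_zero.mpr hn.ne'))
  filter_upwards [hne] with z hz
  rw [deRhamZeta_eq_Gamma_mul R hz, Function.comp_apply]
  ring

theorem integral_exp_neg_sq_mul_self_Ioi :
    (∫ ρ in Ioi (0 : ℝ), Real.exp (-ρ ^ 2) * ρ) = 1 / 2 := by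
  have h := integral_rpow_mul_exp_neg_rpow (p := 2) (q := 1) two_pos (by norm_num)
  norm_num at h
  simpa only [mul_comm, one_div] using h

/-- Residue computation for the de Rham operator on a Riemannian surface: for `R > 0`,
`F(z) = Γ(z+3) R^(-2(z+2))/(2(z+2))` is holomorphic off `P = {-2} ∪ {-3-m}`, has a simple
pole with nonzero residue `r_p` at each `p ∈ P`, the residues are absolutely summable
with sum `(1/2) e^(-R²)`, and as `R → 0⁺` this sum tends to
`∫₀^∞ e^(-ρ²) ρ dρ = 1/2`. -/
theorem deRham_residue_sum :
    (∀ R : ℝ, 0 < R →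
      DifferentiableOn ℂ (deRhamZeta R) deRhamPoleSetᶜ ∧
      ∃ r : ℂ → ℂ,
        (∀ p ∈ deRhamPoleSet, r p ≠ 0 ∧
          Tendsto (fun z : ℂ => (z - p) * deRhamZeta R z)
            (nhdsWithin p {p}ᶜ) (nhds (r p))) ∧
        Summable (fun p : deRhamPoleSet => ‖r (p : ℂ)‖) ∧
        (∑' p : deRhamPoleSet, r (p : ℂ)) =
          (1 / 2 : ℂ) * Complex.exp (-(R : ℂ) ^ 2)) ∧
    Tendsto (fun R : ℝ => (1 / 2 : ℂ) * Complex.exp (-(R : ℂ) ^ 2))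
      (nhdsWithin 0 (Ioi 0)) (nhds ((1 : ℂ) / 2)) ∧
    (∫ ρ in Ioi (0 : ℝ), Real.exp (-ρ ^ 2) * ρ) = 1 / 2 := by
  refine ⟨fun R hR => ⟨differentiableOn_deRhamZeta hR, ?_⟩, ?_, integral_exp_neg_sq_mul_self_Ioi⟩
  · have hinj : Function.Injective fun n : ℕ => (-2 - n : ℂ) := fun a b h => by simpa using h
    let a : ℕ → ℂ := fun n => 1 / 2 * ((-(R : ℂ) ^ 2) ^ n / (n.factorial : ℂ))
    have hR' : (R : ℂ) ≠ 0 := by exact_mod_cast hR.ne'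
    have ha : ∀ n : ℕ, Function.extend (fun n : ℕ => (-2 - n : ℂ)) a 0 (-2 - n) = a n :=
      hinj.extend_apply a 0
    refine ⟨Function.extend (fun n : ℕ => (-2 - n : ℂ)) a 0, ?_⟩
    rw [deRhamPoleSet_eq_range]
    refine ⟨?_, ?_, ?_⟩
    · rintro _ ⟨n, rfl⟩
      simp only [ha]
      refine ⟨?_, tendsto_sub_mul_deRhamZeta hR n⟩
      have hfac : (n.factorial : ℂ) ≠ 0 := Nat.cast_ne_zero.mpr n.factorial_ne_zero
      exact mul_ne_zero (by norm_num)
        (div_ne_zero (pow_ne_zero _ (neg_ne_zero.mpr (pow_ne_zero _ hR'))) hfac)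
    · rw [← (Equiv.ofInjective _ hinj).summable_iff]
      simp only [Function.comp_def, Equiv.ofInjective_apply, ha]
      exact ((NormedSpace.expSeries_div_summable (-(R : ℂ) ^ 2)).mul_left (1 / 2)).norm
    · rw [← (Equiv.ofInjective _ hinj).tsum_eq]
      simp only [Equiv.ofInjective_apply, ha, a]
      rw [tsum_mul_left, Complex.exp_eq_exp_ℂ, congrFun NormedSpace.exp_eq_tsum_div]
  · have h : Continuous fun R : ℝ => (1 / 2 : ℂ) * Complex.exp (-(R : ℂ) ^ 2) := by fun_prop
    have h' := (h.tendsto 0).mono_left (nhdsWithin_le_nhds (s := Ioi 0))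
    simpa using h'
end
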